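/- arXiv:1911.03428 — 8 statements merged into one kernel-verified Lean document; each statement's English description precedes it below -/
import Mathlib

section
/- The set 𝔤 of all matrices X(a,b; x01,x10,x11,x21,x31,x32; y01,y10,y11,y21,y31,y32), as the 14 parameters range over k, is a k-linear subspace of the 7×7 matrices over k of dimension 14 which is closed under the commutator bracket [A,B] = AB − BA; in other words, 𝔤 is a 14-dimensional Lie subalgebra of gl₇(k) (the split Lie algebra of type G₂). -/
open Matrix

/-- The general element of the split Lie algebra of type `G₂`, realized as a `7 × 7` matrix. -/
def Xmat {k : Type*} [Field k]
    (a b x01 x10 x11 x21 x31 x32 y01 y10 y11 y21 y31 y32 : k) :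
    Matrix (Fin 7) (Fin 7) k :=
  !![a, x01, x32, 0, -x21, y10, 2*x11;
     y01, b, x31, x21, 0, -y11, 2*x10;
     y32, y31, -a-b, -y10, y11, 0, 2*y21;
     0, y21, -x10, -a, -y01, -y32, 2*y11;
     -y21, 0, x11, -x01, -b, -y31, 2*y10;
     x10, -x11, 0, -x32, -x31, a+b, 2*x21;
     y11, y10, x21, x11, x10, y21, 0]

/-- The parametrization of the split Lie algebra of type `G₂` by its fourteen coordinates. -/
def xmatLinearMap (k : Type*) [Field k] :
    (Fin 14 → k) →ₗ[k] Matrix (Fin 7) (Fin 7) k where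
  toFun v := Xmat (v 0) (v 1) (v 2) (v 3) (v 4) (v 5) (v 6) (v 7) (v 8) (v 9) (v 10) (v 11)
    (v 12) (v 13)
  map_add' v w := by
    ext i j
    fin_cases i <;> fin_cases j <;> simp [Xmat] <;> ring
  map_smul' c v := by
    ext i j
    fin_cases i <;> fin_cases j <;> simp [Xmat] <;> ring

theorem xmatLinearMap_apply {k : Type*} [Field k] (v : Fin 14 → k) :
    xmatLinearMap k v = Xmat (v 0) (v 1) (v 2) (v 3) (v 4) (v 5) (v 6) (v 7) (v 8) (v 9) (v 10)
      (v 11) (v 12) (v 13) :=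
  rfl

theorem mem_range_xmatLinearMap {k : Type*} [Field k] {M : Matrix (Fin 7) (Fin 7) k} :
    M ∈ LinearMap.range (xmatLinearMap k) ↔
      ∃ a b x01 x10 x11 x21 x31 x32 y01 y10 y11 y21 y31 y32 : k,
        M = Xmat a b x01 x10 x11 x21 x31 x32 y01 y10 y11 y21 y31 y32 := by
  constructor
  · rintro ⟨v, rfl⟩
    exact ⟨_, _, _, _, _, _, _, _, _, _, _, _, _, _, xmatLinearMap_apply v⟩
  · rintro ⟨a, b, x01, x10, x11, x21, x31, x32, y01, y10, y11, y21, y31, y32, rfl⟩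
    exact ⟨![a, b, x01, x10, x11, x21, x31, x32, y01, y10, y11, y21, y31, y32], rfl⟩

/-- The coordinates of a matrix in the image of `xmatLinearMap`, read off from its entries. -/
def xmatCoords {k : Type*} (M : Matrix (Fin 7) (Fin 7) k) : Fin 14 → k :=
  ![M 0 0, M 1 1, M 0 1, M 6 4, M 6 3, M 6 2, M 1 2, M 0 2, M 1 0, M 6 1, M 6 0, M 6 5, M 2 1,
    M 2 0]

theorem xmatCoords_xmatLinearMap {k : Type*} [Field k] (v : Fin 14 → k) :
    xmatCoords (xmatLinearMap k v) = v := by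
  ext i
  fin_cases i <;> rfl

theorem xmatLinearMap_injective (k : Type*) [Field k] :
    Function.Injective (xmatLinearMap k) :=
  Function.LeftInverse.injective xmatCoords_xmatLinearMap

/-- The linear equations expressing the entries of a matrix of the form `Xmat ...` in terms of
the fourteen entries `xmatCoords`. -/
def SatisfiesXmatEquations {k : Type*} [Field k] (M : Matrix (Fin 7) (Fin 7) k) : Prop :=
    M 0 3 = 0 ∧ M 0 4 = -M 6 2 ∧ M 0 5 = M 6 1 ∧ M 0 6 = 2 * M 6 3 ∧
    M 1 3 = M 6 2 ∧ M 1 4 = 0 ∧ M 1 5 = -M 6 0 ∧ M 1 6 = 2 * M 6 4 ∧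
    M 2 2 = -M 0 0 - M 1 1 ∧ M 2 3 = -M 6 1 ∧ M 2 4 = M 6 0 ∧ M 2 5 = 0 ∧
    M 2 6 = 2 * M 6 5 ∧
    M 3 0 = 0 ∧ M 3 1 = M 6 5 ∧ M 3 2 = -M 6 4 ∧ M 3 3 = -M 0 0 ∧
    M 3 4 = -M 1 0 ∧ M 3 5 = -M 2 0 ∧ M 3 6 = 2 * M 6 0 ∧
    M 4 0 = -M 6 5 ∧ M 4 1 = 0 ∧ M 4 2 = M 6 3 ∧ M 4 3 = -M 0 1 ∧
    M 4 4 = -M 1 1 ∧ M 4 5 = -M 2 1 ∧ M 4 6 = 2 * M 6 1 ∧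
    M 5 0 = M 6 4 ∧ M 5 1 = -M 6 3 ∧ M 5 2 = 0 ∧ M 5 3 = -M 0 2 ∧
    M 5 4 = -M 1 2 ∧ M 5 5 = M 0 0 + M 1 1 ∧ M 5 6 = 2 * M 6 2 ∧
    M 6 6 = 0

theorem satisfiesXmatEquations_xmatLinearMap {k : Type*} [Field k] (v : Fin 14 → k) :
    SatisfiesXmatEquations (xmatLinearMap k v) := by
  refine ⟨?_, ?_, ?_, ?_, ?_, ?_, ?_, ?_, ?_, ?_, ?_, ?_, ?_, ?_, ?_, ?_, ?_, ?_, ?_, ?_, ?_, ?_,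
    ?_, ?_, ?_, ?_, ?_, ?_, ?_, ?_, ?_, ?_, ?_, ?_, ?_⟩ <;> rfl

theorem SatisfiesXmatEquations.xmatLinearMap_xmatCoords {k : Type*} [Field k]
    {M : Matrix (Fin 7) (Fin 7) k} (hM : SatisfiesXmatEquations M) :
    xmatLinearMap k (xmatCoords M) = M := by
  obtain ⟨_, _, _, _, _, _, _, _, _, _, _, _, _, _, _, _, _, _, _, _, _, _, _, _, _, _, _, _,
    _, _, _, _, _, _, _⟩ := hM
  ext i j
  fin_cases i <;> fin_cases j <;> first | rfl | (symm; assumption)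

theorem SatisfiesXmatEquations.commutator {k : Type*} [Field k]
    {A B : Matrix (Fin 7) (Fin 7) k} (hA : SatisfiesXmatEquations A)
    (hB : SatisfiesXmatEquations B) : SatisfiesXmatEquations (A * B - B * A) := by
  unfold SatisfiesXmatEquations at hA hB
  refine ⟨?_, ?_, ?_, ?_, ?_, ?_, ?_, ?_, ?_, ?_, ?_, ?_, ?_, ?_, ?_, ?_, ?_, ?_, ?_, ?_, ?_, ?_,
    ?_, ?_, ?_, ?_, ?_, ?_, ?_, ?_, ?_, ?_, ?_, ?_, ?_⟩ <;>
  · simp only [Matrix.sub_apply, Matrix.mul_apply, Fin.sum_univ_seven, hA, hB]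
    ring

/-- The set of all matrices `Xmat ...` is a 14-dimensional `k`-subspace of the `7 × 7`
matrices which is closed under the commutator bracket: a 14-dimensional Lie subalgebra of
`gl₇(k)`, the split Lie algebra of type `G₂`. -/
theorem g2_fourteen_dim_lie_subalgebra (k : Type*) [Field k] [CharZero k] :
    ∃ L : Submodule k (Matrix (Fin 7) (Fin 7) k),
      (L : Set (Matrix (Fin 7) (Fin 7) k)) =
        {M | ∃ a b x01 x10 x11 x21 x31 x32 y01 y10 y11 y21 y31 y32 : k,
          M = Xmat a b x01 x10 x11 x21 x31 x32 y01 y10 y11 y21 y31 y32} ∧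
      Module.finrank k L = 14 ∧
      (∀ A ∈ L, ∀ B ∈ L, A * B - B * A ∈ L) := by
  refine ⟨LinearMap.range (xmatLinearMap k), Set.ext fun _ => mem_range_xmatLinearMap, ?_, ?_⟩
  · rw [LinearMap.finrank_range_of_inj (xmatLinearMap_injective k), Module.finrank_fin_fun]
  · rintro _ ⟨v, rfl⟩ _ ⟨w, rfl⟩
    exact ⟨_, ((satisfiesXmatEquations_xmatLinearMap v).commutator
      (satisfiesXmatEquations_xmatLinearMap w)).xmatLinearMap_xmatCoords⟩
end

section
/- Let t = X(a,b; 0,…,0; 0,…,0) = diag(a, b, −a−b, −a, −b, a+b, 0). For each (i,j) in {(0,1),(1,0),(1,1),(2,1),(3,1),(3,2)} let X_{ij} denote the matrix X with x_{ij} = 1 and all other parameters 0, and Y_{ij} the matrix X with y_{ij} = 1 and all other parameters 0. Then [t, X_{ij}] = (i·b + j·(a−b))·X_{ij} and [t, Y_{ij}] = −(i·b + j·(a−b))·Y_{ij}. (Thus, setting α(t) = b and β(t) = a−b, the matrix X_{ij} is a root vector for the root iα + jβ and Y_{ij} is a root vector for −(iα + jβ).) -/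
open Matrix

theorem Xmat_torus {k : Type*} [Field k] (a b : k) :
    Xmat a b 0 0 0 0 0 0 0 0 0 0 0 0 = diagonal ![a, b, -a - b, -a, -b, a + b, 0] := by
  ext i j
  fin_cases i <;> fin_cases j <;> simp [Xmat]

theorem smul_Xmat {k : Type*} [Field k]
    (c a b x01 x10 x11 x21 x31 x32 y01 y10 y11 y21 y31 y32 : k) :
    c • Xmat a b x01 x10 x11 x21 x31 x32 y01 y10 y11 y21 y31 y32 =
      Xmat (c * a) (c * b) (c * x01) (c * x10) (c * x11) (c * x21) (c * x31) (c * x32)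
        (c * y01) (c * y10) (c * y11) (c * y21) (c * y31) (c * y32) := by
  ext i j
  fin_cases i <;> fin_cases j <;> simp [Xmat] <;> ring

/-- The adjoint action of the diagonal torus scales each root coordinate by its root. -/
theorem Xmat_torus_commutator {k : Type*} [Field k]
    (a b x01 x10 x11 x21 x31 x32 y01 y10 y11 y21 y31 y32 : k) :
    Xmat a b 0 0 0 0 0 0 0 0 0 0 0 0 * Xmat 0 0 x01 x10 x11 x21 x31 x32 y01 y10 y11 y21 y31 y32 -
      Xmat 0 0 x01 x10 x11 x21 x31 x32 y01 y10 y11 y21 y31 y32 * Xmat a b 0 0 0 0 0 0 0 0 0 0 0 0 =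
      Xmat 0 0 ((a - b) * x01) (b * x10) (a * x11) ((a + b) * x21) ((a + 2 * b) * x31)
        ((2 * a + b) * x32) (-(a - b) * y01) (-b * y10) (-a * y11) (-(a + b) * y21)
        (-(a + 2 * b) * y31) (-(2 * a + b) * y32) := by
  ext i j
  rw [Xmat_torus, Matrix.sub_apply, diagonal_mul, mul_diagonal]
  fin_cases i <;> fin_cases j <;> simp [Xmat] <;> ring

/-- For `t = diag(a, b, -a-b, -a, -b, a+b, 0)`, each `X_{ij}` is a root vector for the root
`iα + jβ` (where `α(t) = b`, `β(t) = a - b`), and each `Y_{ij}` is a root vector for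
`-(iα + jβ)`:  `[t, X_{ij}] = (i·b + j·(a-b)) • X_{ij}` and
`[t, Y_{ij}] = -(i·b + j·(a-b)) • Y_{ij}`. -/
theorem g2_root_vectors (k : Type*) [Field k] [CharZero k] (a b : k) :
    letI t : Matrix (Fin 7) (Fin 7) k := Xmat a b 0 0 0 0 0 0 0 0 0 0 0 0
    letI X01 : Matrix (Fin 7) (Fin 7) k := Xmat 0 0 1 0 0 0 0 0 0 0 0 0 0 0
    letI X10 : Matrix (Fin 7) (Fin 7) k := Xmat 0 0 0 1 0 0 0 0 0 0 0 0 0 0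
    letI X11 : Matrix (Fin 7) (Fin 7) k := Xmat 0 0 0 0 1 0 0 0 0 0 0 0 0 0
    letI X21 : Matrix (Fin 7) (Fin 7) k := Xmat 0 0 0 0 0 1 0 0 0 0 0 0 0 0
    letI X31 : Matrix (Fin 7) (Fin 7) k := Xmat 0 0 0 0 0 0 1 0 0 0 0 0 0 0
    letI X32 : Matrix (Fin 7) (Fin 7) k := Xmat 0 0 0 0 0 0 0 1 0 0 0 0 0 0
    letI Y01 : Matrix (Fin 7) (Fin 7) k := Xmat 0 0 0 0 0 0 0 0 1 0 0 0 0 0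
    letI Y10 : Matrix (Fin 7) (Fin 7) k := Xmat 0 0 0 0 0 0 0 0 0 1 0 0 0 0
    letI Y11 : Matrix (Fin 7) (Fin 7) k := Xmat 0 0 0 0 0 0 0 0 0 0 1 0 0 0
    letI Y21 : Matrix (Fin 7) (Fin 7) k := Xmat 0 0 0 0 0 0 0 0 0 0 0 1 0 0
    letI Y31 : Matrix (Fin 7) (Fin 7) k := Xmat 0 0 0 0 0 0 0 0 0 0 0 0 1 0
    letI Y32 : Matrix (Fin 7) (Fin 7) k := Xmat 0 0 0 0 0 0 0 0 0 0 0 0 0 1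
    (t * X01 - X01 * t = ((0:k)*b + (1:k)*(a-b)) • X01) ∧
    (t * X10 - X10 * t = ((1:k)*b + (0:k)*(a-b)) • X10) ∧
    (t * X11 - X11 * t = ((1:k)*b + (1:k)*(a-b)) • X11) ∧
    (t * X21 - X21 * t = ((2:k)*b + (1:k)*(a-b)) • X21) ∧
    (t * X31 - X31 * t = ((3:k)*b + (1:k)*(a-b)) • X31) ∧
    (t * X32 - X32 * t = ((3:k)*b + (2:k)*(a-b)) • X32) ∧
    (t * Y01 - Y01 * t = -((0:k)*b + (1:k)*(a-b)) • Y01) ∧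
    (t * Y10 - Y10 * t = -((1:k)*b + (0:k)*(a-b)) • Y10) ∧
    (t * Y11 - Y11 * t = -((1:k)*b + (1:k)*(a-b)) • Y11) ∧
    (t * Y21 - Y21 * t = -((2:k)*b + (1:k)*(a-b)) • Y21) ∧
    (t * Y31 - Y31 * t = -((3:k)*b + (1:k)*(a-b)) • Y31) ∧
    (t * Y32 - Y32 * t = -((3:k)*b + (2:k)*(a-b)) • Y32) := by
  simp only [Xmat_torus_commutator, smul_Xmat, mul_zero, mul_one]
  refine ⟨?_, ?_, ?_, ?_, ?_, ?_, ?_, ?_, ?_, ?_, ?_, ?_⟩ <;> congr 1 <;> ring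
end

section
/- For all x, x10, x11, x21, x31, x32 in a field k of characteristic zero, the following identity of 7×7 matrices holds: u(x) · E(x10, x11, x21, x31, x32) · u(x)⁻¹ = E(x10, x·x10 + x11, x21, x31, x·x31 + x32). -/
open Matrix

/-- The exponential of a `7 × 7` matrix as a finite sum; for a nilpotent matrix (such as any
nilpotent element of `G₂ ⊂ gl₇`) this is the genuine exponential, since `A ^ 7 = 0`. -/
noncomputable def mexp {k : Type*} [Field k] (A : Matrix (Fin 7) (Fin 7) k) :
    Matrix (Fin 7) (Fin 7) k :=
  ∑ i ∈ Finset.range 7, (Nat.factorial i : k)⁻¹ • A ^ i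

/-- `E(x10, x11, x21, x31, x32)`: the exponential of the nilpotent element of `G₂` with upper
coordinates `x10, x11, x21, x31, x32` (and `x01 = 0`). -/
noncomputable def Emat {k : Type*} [Field k] (x10 x11 x21 x31 x32 : k) :
    Matrix (Fin 7) (Fin 7) k :=
  mexp (Xmat 0 0 0 x10 x11 x21 x31 x32 0 0 0 0 0 0)

/-- `Ē(y10, y11, y21, y31, y32)`: the exponential of the nilpotent element of `G₂` with lower
coordinates `y10, y11, y21, y31, y32` (and `y01 = 0`). -/
noncomputable def Ebar {k : Type*} [Field k] (y10 y11 y21 y31 y32 : k) :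
    Matrix (Fin 7) (Fin 7) k :=
  mexp (Xmat 0 0 0 0 0 0 0 0 0 y10 y11 y21 y31 y32)

/-- `u(x)`: the exponential of the nilpotent element of `G₂` with `x01 = x`, i.e. the simple
root vector in the Levi subgroup `GL₂ = M ⊂ G₂`. -/
noncomputable def umat {k : Type*} [Field k] (x : k) : Matrix (Fin 7) (Fin 7) k :=
  mexp (Xmat 0 0 x 0 0 0 0 0 0 0 0 0 0 0)

/-- `z(t) = diag(t, t, t⁻², t⁻¹, t⁻¹, t², 1)`: the image of the central element `t·I₂` of the
Levi subgroup `GL₂ = M ⊂ G₂`. -/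
noncomputable def zmat {k : Type*} [Field k] (t : k) : Matrix (Fin 7) (Fin 7) k :=
  Matrix.diagonal ![t, t, (t^2)⁻¹, t⁻¹, t⁻¹, t^2, 1]
/-- An intertwining relation `U * A = B * U` passes to the exponentials. -/
lemma mul_mexp_eq_mexp_mul {k : Type*} [Field k] {U A B : Matrix (Fin 7) (Fin 7) k}
    (h : U * A = B * U) : U * mexp A = mexp B * U := by
  have hpow (n : ℕ) : U * A ^ n = B ^ n * U := SemiconjBy.pow_right h n
  simp only [mexp, Finset.mul_sum, Finset.sum_mul, mul_smul_comm, smul_mul_assoc, hpow]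

/-- The generator of `u(x)` squares to zero. -/
lemma Xmat_levi_sq {k : Type*} [Field k] (x : k) :
    Xmat 0 0 x 0 0 0 0 0 0 0 0 0 0 0 * Xmat 0 0 x 0 0 0 0 0 0 0 0 0 0 0 = 0 := by
  simp [Xmat, ← Matrix.ext_iff, Fin.forall_fin_succ]

lemma umat_eq_one_add {k : Type*} [Field k] (x : k) :
    umat x = 1 + Xmat 0 0 x 0 0 0 0 0 0 0 0 0 0 0 := by
  have hpow (n : ℕ) : Xmat 0 0 x 0 0 0 0 0 0 0 0 0 0 0 ^ (n + 2) = 0 := by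
    rw [pow_add, sq, Xmat_levi_sq, mul_zero]
  simp [umat, mexp, Finset.sum_range_succ, hpow 0, hpow 1, hpow 2, hpow 3, hpow 4]

lemma isUnit_det_umat {k : Type*} [Field k] (x : k) : IsUnit (umat x).det := by
  rw [← Matrix.isUnit_iff_isUnit_det, umat_eq_one_add]
  exact IsNilpotent.isUnit_one_add ⟨2, by rw [sq, Xmat_levi_sq]⟩

/-- `u(x)` intertwines the generators of the two sides of the conjugation formula. -/
lemma umat_mul_Xmat {k : Type*} [Field k] (x x10 x11 x21 x31 x32 : k) :
    umat x * Xmat 0 0 0 x10 x11 x21 x31 x32 0 0 0 0 0 0 =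
      Xmat 0 0 0 x10 (x * x10 + x11) x21 x31 (x * x31 + x32) 0 0 0 0 0 0 * umat x := by
  rw [umat_eq_one_add, add_mul, mul_add, one_mul, mul_one]
  simp [Xmat]
  ring_nf
  simp

/-- Conjugation of `E(x10,x11,x21,x31,x32)` by `u(x)`:
`u(x) · E(x10,x11,x21,x31,x32) · u(x)⁻¹ = E(x10, x·x10 + x11, x21, x31, x·x31 + x32)`. -/
theorem uM_conj_E (k : Type*) [Field k] [CharZero k] (x x10 x11 x21 x31 x32 : k) :
    umat x * Emat x10 x11 x21 x31 x32 * (umat x)⁻¹ =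
      Emat x10 (x*x10 + x11) x21 x31 (x*x31 + x32) := by
  rw [Emat, mul_mexp_eq_mexp_mul (umat_mul_Xmat x x10 x11 x21 x31 x32),
    Matrix.mul_nonsing_inv_cancel_right _ _ (isUnit_det_umat x), Emat]
end

section
/- For every continuous compactly supported function f : k⁵ → ℂ, ∫_k ∫_{k⁴} f(x10, x·x10, x21, x31, x·x31 + x32) · |x10| d(x10, x21, x31, x32) dx = ∫_{k⁵} f(x10, x11, x21, x31, x32) d(x10, x11, x21, x31, x32). (Lemma 1.5.2: with the measure |x10| dx10 dx21 dx31 dx32 on the quotient D of N' by the conjugation action of U_M, integration over the group N is recovered by double integration over U_M and D.) -/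
open MeasureTheory

open scoped Pointwise NNReal ENNReal

/-- Multiplication by `p` divides the Haar measure of the unit ball of `ℚ_[p]` by `p`. -/
lemma Padic.measure_closedBall_zero_one_eq {p : ℕ} [Fact p.Prime]
    [MeasurableSpace ℚ_[p]] [BorelSpace ℚ_[p]]
    (μ : Measure ℚ_[p]) [μ.IsAddLeftInvariant] :
    μ (Metric.closedBall 0 1) = p * μ (Metric.ball 0 1) := by
  have hunion : Metric.closedBall (0 : ℚ_[p]) 1
      = ⋃ i ∈ Finset.range p, Metric.ball (i : ℚ_[p]) 1 := by
    ext x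
    simp only [Metric.mem_closedBall, dist_zero_right, Set.mem_iUnion, Finset.mem_range,
      Metric.mem_ball, exists_prop]
    constructor
    · intro hx
      obtain ⟨n, hn, hxn⟩ := PadicInt.exists_mem_range (⟨x, hx⟩ : ℤ_[p])
      refine ⟨n, hn, ?_⟩
      rw [IsLocalRing.mem_maximalIdeal, PadicInt.mem_nonunits] at hxn
      rw [dist_eq_norm]
      exact hxn
    · rintro ⟨n, -, hxn⟩
      rw [dist_eq_norm] at hxn
      have := Padic.nonarchimedean (x - (n : ℚ_[p])) (n : ℚ_[p])
      rw [sub_add_cancel] at this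
      exact this.trans (max_le hxn.le (Padic.norm_int_le_one n))
  have hdisj : (Finset.range p : Set ℕ).PairwiseDisjoint
      (fun i : ℕ => Metric.ball (i : ℚ_[p]) 1) := by
    intro i hi j hj hij
    refine Set.disjoint_left.2 fun x hxi hxj => hij ?_
    simp only [Finset.coe_range, Set.mem_Iio] at hi hj
    rw [Metric.mem_ball, dist_eq_norm] at hxi hxj
    have hlt : ‖(((i : ℤ) - (j : ℤ) : ℤ) : ℚ_[p])‖ < 1 := by
      have := Padic.nonarchimedean (x - (j : ℚ_[p])) (-(x - (i : ℚ_[p])))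
      rw [norm_neg] at this
      refine lt_of_le_of_lt ?_ (max_lt hxj hxi)
      rwa [show x - (j : ℚ_[p]) + -(x - (i : ℚ_[p])) = (((i : ℤ) - (j : ℤ) : ℤ) : ℚ_[p]) by
        push_cast; ring] at this
    rw [Padic.norm_intCast_lt_one_iff] at hlt
    have := Int.eq_zero_of_abs_lt_dvd hlt (by rw [abs_lt]; omega)
    omega
  rw [hunion, measure_biUnion_finset hdisj fun i _ => Metric.isOpen_ball.measurableSet]
  have hball (i : ℕ) : μ (Metric.ball (i : ℚ_[p]) 1) = μ (Metric.ball 0 1) := by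
    rw [← measure_preimage_add μ (i : ℚ_[p]), preimage_add_ball, sub_self]
  simp [hball]

/-- The Haar character of `ℚ_[p]ˣ` acting on `ℚ_[p]` is the `p`-adic norm. -/
lemma Padic.distribHaarChar_eq_nnnorm {p : ℕ} [Fact p.Prime] (u : ℚ_[p]ˣ) :
    distribHaarChar ℚ_[p] u = ‖(u : ℚ_[p])‖₊ := by
  borelize ℚ_[p]
  let μ : Measure ℚ_[p] := Measure.addHaar
  have hp : (p : ℚ_[p]) ≠ 0 := by exact_mod_cast (Fact.out : p.Prime).ne_zero
  have hp0 : (p : ℝ) ≠ 0 := by exact_mod_cast (Fact.out : p.Prime).ne_zero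
  have hB0 : μ (Metric.closedBall 0 1) ≠ 0 :=
    (Metric.measure_closedBall_pos μ 0 one_pos).ne'
  have hBt : μ (Metric.closedBall 0 1) ≠ ∞ := measure_closedBall_lt_top.ne
  have hunit (v : ℚ_[p]ˣ) (hv : ‖(v : ℚ_[p])‖ = 1) : distribHaarChar ℚ_[p] v = 1 := by
    refine distribHaarChar_eq_of_measure_smul_eq_mul (μ := μ) hB0 hBt ?_
    have : v • Metric.closedBall (0 : ℚ_[p]) 1 = Metric.closedBall 0 1 := by
      rw [Units.smul_def, smul_closedBall' v.ne_zero]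
      simp [hv]
    simp [this]
  have hunif : distribHaarChar ℚ_[p] (Units.mk0 (p : ℚ_[p]) hp) = ‖(p : ℚ_[p])‖₊ := by
    have hset : Units.mk0 (p : ℚ_[p]) hp • Metric.closedBall (0 : ℚ_[p]) 1
        = Metric.ball 0 1 := by
      rw [Units.smul_def, Units.val_mk0, smul_closedBall' hp]
      ext x
      simp only [smul_zero, mul_one, Metric.mem_closedBall, dist_zero_right, Metric.mem_ball,
        Padic.norm_p]
      have := Padic.norm_le_pow_iff_norm_lt_pow_add_one x (-1)
      simpa using this
    refine distribHaarChar_eq_of_measure_smul_eq_mul (μ := μ) hB0 hBt ?_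
    have hn : ‖(p : ℚ_[p])‖₊ = (p : ℝ≥0)⁻¹ := by
      ext
      simp
    have hp' : (p : ℝ≥0) ≠ 0 := by exact_mod_cast (Fact.out : p.Prime).ne_zero
    rw [hset, Padic.measure_closedBall_zero_one_eq, hn, ← mul_assoc, ENNReal.coe_inv hp',
      ENNReal.coe_natCast, ENNReal.inv_mul_cancel (by exact_mod_cast hp')
        (ENNReal.natCast_ne_top p), one_mul]
  obtain ⟨n, hn⟩ : ∃ n : ℤ, ‖(u : ℚ_[p])‖ = (p : ℝ) ^ (-n) :=
    ⟨(u : ℚ_[p]).valuation, Padic.norm_eq_zpow_neg_valuation u.ne_zero⟩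
  set w : ℚ_[p]ˣ := Units.mk0 (p : ℚ_[p]) hp with hw
  have hv : ‖((w ^ (-n) * u : ℚ_[p]ˣ) : ℚ_[p])‖ = 1 := by
    simp only [Units.val_mul, Units.val_zpow_eq_zpow_val, norm_mul, norm_zpow, hn, hw,
      Units.val_mk0, Padic.norm_p]
    rw [← mul_zpow, inv_mul_cancel₀ hp0, one_zpow]
  have hu : u = w ^ n * (w ^ (-n) * u) := by
    rw [← mul_assoc, ← zpow_add, add_neg_cancel, zpow_zero, one_mul]
  rw [hu, map_mul, hunit _ hv, map_zpow, hunif, mul_one, Units.val_mul, nnnorm_mul]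
  have hv' : ‖((w ^ (-n) * u : ℚ_[p]ˣ) : ℚ_[p])‖₊ = 1 := by
    ext
    simpa using hv
  rw [hv', mul_one, Units.val_zpow_eq_zpow_val, nnnorm_zpow, hw, Units.val_mk0]

section Scaling

variable {p : ℕ} [Fact p.Prime] [MeasurableSpace ℚ_[p]] [BorelSpace ℚ_[p]]
  (μ : Measure ℚ_[p]) [μ.IsAddHaarMeasure]

lemma Padic.map_mul_right_addHaar {a : ℚ_[p]} (ha : a ≠ 0) :
    μ.map (· * a) = ‖a‖₊⁻¹ • μ := by
  ext s hs
  rw [Measure.map_apply (by fun_prop) hs]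
  have hpre : (· * a) ⁻¹' s = (Units.mk0 a ha)⁻¹ • s := by
    rw [← Set.preimage_smul]
    ext x
    simp [Units.smul_def, mul_comm]
  rw [hpre, ← distribHaarChar_mul μ, Padic.distribHaarChar_eq_nnnorm]
  rw [Measure.smul_apply, ENNReal.smul_def, smul_eq_mul, Units.val_inv_eq_inv_val, Units.val_mk0,
    nnnorm_inv]

variable {E : Type*} [NormedAddCommGroup E]

lemma Padic.integrable_comp_mul_right {φ : ℚ_[p] → E} (hφ : Integrable φ μ) {a : ℚ_[p]}
    (ha : a ≠ 0) : Integrable (fun x => φ (x * a)) μ := by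
  have h : Integrable φ (μ.map (· * a)) := by
    rw [Padic.map_mul_right_addHaar μ ha]
    exact hφ.smul_measure_nnreal
  exact (Homeomorph.mulRight₀ a ha).measurableEmbedding.integrable_map_iff.1 h

lemma Padic.norm_smul_integral_comp_mul_right [NormedSpace ℝ E] (φ : ℚ_[p] → E) {a : ℚ_[p]}
    (ha : a ≠ 0) : ‖a‖ • ∫ x, φ (x * a) ∂μ = ∫ x, φ x ∂μ := by
  have h := (Homeomorph.mulRight₀ a ha).measurableEmbedding.integral_map (μ := μ) φ
  simp only [Homeomorph.coe_mulRight₀] at h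
  rw [← h, Padic.map_mul_right_addHaar μ ha, integral_smul_nnreal_measure, NNReal.smul_def,
    smul_smul]
  simp [ha]

lemma Padic.integral_integral_comp_mul_smul_norm [NormedSpace ℝ E]
    {G : ℚ_[p] × ℚ_[p] → E} (hGm : StronglyMeasurable G) (hG : Integrable G (μ.prod μ)) :
    ∫ x, ∫ a, ‖a‖ • G (a, x * a) ∂μ ∂μ = ∫ a, ∫ b, G (a, b) ∂μ ∂μ := by
  have hne : ∀ᵐ a ∂μ, a ≠ 0 := by
    simp [ae_iff]
  have hint : Integrable (Function.uncurry fun x a => ‖a‖ • G (a, x * a)) (μ.prod μ) := by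
    have hm : StronglyMeasurable (Function.uncurry fun x a => ‖a‖ • G (a, x * a)) := by
      refine StronglyMeasurable.smul (f := fun z : ℚ_[p] × ℚ_[p] => ‖z.2‖)
        (g := fun z : ℚ_[p] × ℚ_[p] => G (z.2, z.1 * z.2)) ?_ ?_
      · exact (by fun_prop : Measurable _).stronglyMeasurable
      · exact hGm.comp_measurable (by fun_prop)
    rw [integrable_prod_iff' hm.aestronglyMeasurable]
    constructor
    · filter_upwards [hne, hG.prod_right_ae] with a ha hGa
      exact (Padic.integrable_comp_mul_right μ hGa ha).smul ‖a‖
    · refine hG.norm.integral_prod_left.congr ?_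
      filter_upwards [hne] with a ha
      simp only [Function.uncurry_apply_pair, norm_smul, norm_norm]
      rw [integral_const_mul, ← smul_eq_mul,
        Padic.norm_smul_integral_comp_mul_right μ (fun b => ‖G (a, b)‖) ha]
  rw [integral_integral_swap hint]
  refine integral_congr_ae ?_
  filter_upwards [hne] with a ha
  rw [integral_smul, Padic.norm_smul_integral_comp_mul_right μ (fun b => G (a, b)) ha]

end Scaling

/-- Lemma 1.5.2: with the measure `|x10| dx10 dx21 dx31 dx32` on the quotient `D` of `N'`
by the conjugation action of `U_M`, integration over the group `N` is recovered by double
integration over `U_M` and `D`: for every continuous compactly supported `f : k⁵ → ℂ`,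
`∫_k ∫_{k⁴} f(x10, x·x10, x21, x31, x·x31 + x32) |x10| d(x10,x21,x31,x32) dx
  = ∫_{k⁵} f`. -/
theorem orbit_space_measure_D (p : ℕ) [Fact p.Prime]
    [MeasurableSpace ℚ_[p]] [BorelSpace ℚ_[p]]
    (μ : Measure ℚ_[p]) [μ.IsAddHaarMeasure]
    (f : ℚ_[p] × ℚ_[p] × ℚ_[p] × ℚ_[p] × ℚ_[p] → ℂ)
    (hf : Continuous f) (hsupp : HasCompactSupport f) :
    (∫ x, ∫ x10, ∫ x21, ∫ x31, ∫ x32,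
        f (x10, x*x10, x21, x31, x*x31 + x32) * (‖x10‖ : ℂ) ∂μ ∂μ ∂μ ∂μ ∂μ)
      = ∫ x10, ∫ x11, ∫ x21, ∫ x31, ∫ x32,
          f (x10, x11, x21, x31, x32) ∂μ ∂μ ∂μ ∂μ ∂μ := by
  have hcs {X Y : Type} [TopologicalSpace X] [TopologicalSpace Y] [T2Space X] [T2Space Y]
      {φ : X × Y → ℂ} (hφs : HasCompactSupport φ) (x : X) :
      HasCompactSupport fun y => φ (x, y) := by
    refine HasCompactSupport.intro (hφs.isCompact.image continuous_snd) fun y hy => ?_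
    by_contra h
    exact hy ⟨(x, y), subset_tsupport _ h, rfl⟩
  let G : ℚ_[p] × ℚ_[p] → ℂ := fun z => ∫ w, f (z.1, z.2, w) ∂(μ.prod (μ.prod μ))
  let e := Homeomorph.prodAssoc ℚ_[p] ℚ_[p] (ℚ_[p] × ℚ_[p] × ℚ_[p])
  have hfe : Continuous (f ∘ e) := hf.comp e.continuous
  have hfes : HasCompactSupport (f ∘ e) := hsupp.comp_homeomorph e
  have hGm : StronglyMeasurable G := hfe.stronglyMeasurable.integral_prod_right'
  have hG : Integrable G (μ.prod μ) :=
    (hfe.integrable_of_hasCompactSupport hfes).integral_prod_left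
  have hGeq (a b : ℚ_[p]) :
      ∫ x21, ∫ x31, ∫ x32, f (a, b, x21, x31, x32) ∂μ ∂μ ∂μ = G (a, b) := by
    have hc : Continuous fun w => f (a, b, w) := by fun_prop
    have hs : HasCompactSupport fun w => f (a, b, w) := hcs (hcs hsupp a) b
    simp only [G]
    rw [integral_prod _ (hc.integrable_of_hasCompactSupport hs)]
    refine integral_congr_ae (.of_forall fun c => ?_)
    have hc' : Continuous fun w => f (a, b, c, w) := by fun_prop
    exact (integral_prod _ (hc'.integrable_of_hasCompactSupport (hcs hs c))).symm
  have hshift (x a : ℚ_[p]) :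
      ∫ x21, ∫ x31, ∫ x32, f (a, x * a, x21, x31, x * x31 + x32) * (‖a‖ : ℂ) ∂μ ∂μ ∂μ
        = ‖a‖ • G (a, x * a) := by
    have h (c d : ℚ_[p]) : ∫ t, f (a, x * a, c, d, x * d + t) ∂μ
        = ∫ t, f (a, x * a, c, d, t) ∂μ :=
      integral_add_left_eq_self (fun t => f (a, x * a, c, d, t)) (x * d)
    simp only [integral_mul_const, h, hGeq]
    rw [Complex.real_smul, mul_comm]
  simp only [hshift, hGeq]
  exact Padic.integral_integral_comp_mul_smul_norm μ hGm hG
end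

section
/- For every t in k^× and all x10, x11, x21, x31, x32, y10, y11, y21, y31, y32 in k, the following identities of 7×7 matrices hold: z(t) · E(x10,x11,x21,x31,x32) · z(t)⁻¹ = E(t·x10, t·x11, t²·x21, t³·x31, t³·x32), and z(t) · Ē(y10,y11,y21,y31,y32) · z(t)⁻¹ = Ē(t⁻¹·y10, t⁻¹·y11, t⁻²·y21, t⁻³·y31, t⁻³·y32). -/
open Matrix

/-- The finite exponential commutes with conjugation. -/
theorem conj_mexp_of_mul_eq {k : Type*} [Field k] {Z W A B : Matrix (Fin 7) (Fin 7) k}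
    (hZW : Z * W = 1) (h : Z * A = B * Z) : Z * mexp A * W = mexp B := by
  have hpow (i : ℕ) : Z * A ^ i = B ^ i * Z :=
    (show SemiconjBy Z A B from h).pow_right i
  have hexp : Z * mexp A = mexp B * Z := by
    simp only [mexp, Finset.mul_sum, Finset.sum_mul, Matrix.mul_smul, Matrix.smul_mul, hpow]
  rw [hexp, Matrix.mul_assoc, hZW, Matrix.mul_one]

/-- `z(t)` is invertible for `t ≠ 0`. -/
theorem zmat_mul_inv {k : Type*} [Field k] {t : k} (ht : t ≠ 0) :
    zmat t * (zmat t)⁻¹ = 1 := by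
  apply Matrix.mul_nonsing_inv
  rw [zmat, Matrix.det_diagonal, isUnit_iff_ne_zero, Finset.prod_ne_zero_iff]
  intro i _
  fin_cases i <;> simp [ht]

/-- Conjugation by `z(t)` on the Lie algebra, with trivial Levi component. -/
theorem zmat_mul_Xmat {k : Type*} [Field k] {t : k} (ht : t ≠ 0)
    (x10 x11 x21 x31 x32 y10 y11 y21 y31 y32 : k) :
    zmat t * Xmat 0 0 0 x10 x11 x21 x31 x32 0 y10 y11 y21 y31 y32 =
      Xmat 0 0 0 (t*x10) (t*x11) (t^2*x21) (t^3*x31) (t^3*x32)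
        0 (t⁻¹*y10) (t⁻¹*y11) ((t^2)⁻¹*y21) ((t^3)⁻¹*y31) ((t^3)⁻¹*y32) * zmat t := by
  ext i j
  rw [zmat, Matrix.diagonal_mul, Matrix.mul_diagonal]
  fin_cases i <;> fin_cases j <;> simp [Xmat] <;> field_simp

/-- Conjugation by the central element `z(t) = diag(t,t,t⁻²,t⁻¹,t⁻¹,t²,1)` of the Levi
subgroup scales the coordinates of `N` by `(t, t, t², t³, t³)` and the coordinates of the
opposite unipotent radical `N̄` by `(t⁻¹, t⁻¹, t⁻², t⁻³, t⁻³)`. -/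
theorem zM_conj_E_Ebar (k : Type*) [Field k] [CharZero k] (t : k) (ht : t ≠ 0)
    (x10 x11 x21 x31 x32 y10 y11 y21 y31 y32 : k) :
    zmat t * Emat x10 x11 x21 x31 x32 * (zmat t)⁻¹ =
      Emat (t*x10) (t*x11) (t^2*x21) (t^3*x31) (t^3*x32) ∧
    zmat t * Ebar y10 y11 y21 y31 y32 * (zmat t)⁻¹ =
      Ebar (t⁻¹*y10) (t⁻¹*y11) ((t^2)⁻¹*y21) ((t^3)⁻¹*y31) ((t^3)⁻¹*y32) := by
  constructor
  · apply conj_mexp_of_mul_eq (zmat_mul_inv ht)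
    simpa using zmat_mul_Xmat ht x10 x11 x21 x31 x32 0 0 0 0 0
  · apply conj_mexp_of_mul_eq (zmat_mul_inv ht)
    simpa using zmat_mul_Xmat ht 0 0 0 0 0 y10 y11 y21 y31 y32
end

section
/- (Homogeneity, Lemma 1.5.4.) Regard y10, y11, y21, y31, y32 as functions of (x21, x31, x32), and set a = y10·y11 + y21, b = y10², c = −y11² + (1/2)y11·y21 − y32, d = −(1/2)y10·y11 + y21 − y31, t1 = −(ad − bc)/c, t2 = −c, x1 = a/c, x2 = d/c, assuming c ≠ 0. Then for every s ∈ k^×, replacing (x21, x31, x32) by (s·x21, s·x31, s²·x32) changes (y10, y11, y21, y31, y32) to (y10, s⁻¹·y11, s⁻¹·y21, s⁻¹·y31, s⁻²·y32); consequently it leaves t1 unchanged, changes t2 to s⁻²·t2, and changes x1 and x2 to s·x1 and s·x2 respectively. -/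
noncomputable section

variable {k : Type*} [Field k]

/-- `D = x21² + x32`. -/
def Dv (x21 x31 x32 : k) : k := x21^2 + x32
/-- `y10 = -x32/D`. -/
def y10v (x21 x31 x32 : k) : k := -x32 / Dv x21 x31 x32
/-- `y11 = (-x31 + (1/2)x21)/D`. -/
def y11v (x21 x31 x32 : k) : k := (-x31 + (1/2)*x21) / Dv x21 x31 x32
/-- `y21 = -x21/D`. -/
def y21v (x21 x31 x32 : k) : k := -x21 / Dv x21 x31 x32
/-- `y31 = ((1/2)x32·x21)/D²`. -/
def y31v (x21 x31 x32 : k) : k := ((1/2)*x32*x21) / (Dv x21 x31 x32)^2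
/-- `y32 = ((3/4)x21² + x32 + (1/2)x21·x31)/D²`. -/
def y32v (x21 x31 x32 : k) : k :=
  ((3/4)*x21^2 + x32 + (1/2)*x21*x31) / (Dv x21 x31 x32)^2
/-- `a = y10·y11 + y21`, the `(1,1)` entry of the Levi component `m`. -/
def av (x21 x31 x32 : k) : k :=
  y10v x21 x31 x32 * y11v x21 x31 x32 + y21v x21 x31 x32
/-- `b = y10²`, the `(1,2)` entry of the Levi component `m`. -/
def bv (x21 x31 x32 : k) : k := (y10v x21 x31 x32)^2
/-- `c = -y11² + (1/2)y11·y21 - y32`, the `(2,1)` entry of the Levi component `m`. -/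
def cv (x21 x31 x32 : k) : k :=
  -(y11v x21 x31 x32)^2 + (1/2)*y11v x21 x31 x32*y21v x21 x31 x32 - y32v x21 x31 x32
/-- `d = -(1/2)y10·y11 + y21 - y31`, the `(2,2)` entry of the Levi component `m`. -/
def dv (x21 x31 x32 : k) : k :=
  -(1/2)*y10v x21 x31 x32*y11v x21 x31 x32 + y21v x21 x31 x32 - y31v x21 x31 x32
/-- `t1 = -(ad - bc)/c`, first diagonal entry of the Bruhat torus part of `m`. -/
def t1v (x21 x31 x32 : k) : k :=
  -(av x21 x31 x32 * dv x21 x31 x32 - bv x21 x31 x32 * cv x21 x31 x32) / cv x21 x31 x32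
/-- `t2 = -c`, second diagonal entry of the Bruhat torus part of `m`. -/
def t2v (x21 x31 x32 : k) : k := -cv x21 x31 x32
/-- `x1 = a/c`, the coordinate of the left unipotent part `u1` in the Bruhat
decomposition of `m`. -/
def x1v (x21 x31 x32 : k) : k := av x21 x31 x32 / cv x21 x31 x32
/-- `x2 = d/c`, the coordinate of the right unipotent part `u2` in the Bruhat
decomposition of `m`. -/
def x2v (x21 x31 x32 : k) : k := dv x21 x31 x32 / cv x21 x31 x32

theorem Dv_smul (s x21 x31 x32 : k) :
    Dv (s*x21) (s*x31) (s^2*x32) = s^2 * Dv x21 x31 x32 := by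
  unfold Dv
  ring

theorem y10v_smul {s : k} (hs : s ≠ 0) (x21 x31 x32 : k) :
    y10v (s*x21) (s*x31) (s^2*x32) = y10v x21 x31 x32 := by
  simp only [y10v, Dv_smul]
  generalize Dv x21 x31 x32 = D
  field_simp

theorem y11v_smul {s : k} (hs : s ≠ 0) (x21 x31 x32 : k) :
    y11v (s*x21) (s*x31) (s^2*x32) = s⁻¹ * y11v x21 x31 x32 := by
  simp only [y11v, Dv_smul]
  generalize Dv x21 x31 x32 = D
  field_simp

theorem y21v_smul {s : k} (hs : s ≠ 0) (x21 x31 x32 : k) :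
    y21v (s*x21) (s*x31) (s^2*x32) = s⁻¹ * y21v x21 x31 x32 := by
  simp only [y21v, Dv_smul]
  generalize Dv x21 x31 x32 = D
  field_simp

theorem y31v_smul {s : k} (hs : s ≠ 0) (x21 x31 x32 : k) :
    y31v (s*x21) (s*x31) (s^2*x32) = s⁻¹ * y31v x21 x31 x32 := by
  simp only [y31v, Dv_smul]
  generalize Dv x21 x31 x32 = D
  field_simp

theorem y32v_smul {s : k} (hs : s ≠ 0) (x21 x31 x32 : k) :
    y32v (s*x21) (s*x31) (s^2*x32) = (s^2)⁻¹ * y32v x21 x31 x32 := by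
  simp only [y32v, Dv_smul]
  generalize Dv x21 x31 x32 = D
  field_simp

theorem av_smul {s : k} (hs : s ≠ 0) (x21 x31 x32 : k) :
    av (s*x21) (s*x31) (s^2*x32) = s⁻¹ * av x21 x31 x32 := by
  simp only [av, y10v_smul hs, y11v_smul hs, y21v_smul hs]
  ring

theorem bv_smul {s : k} (hs : s ≠ 0) (x21 x31 x32 : k) :
    bv (s*x21) (s*x31) (s^2*x32) = bv x21 x31 x32 := by
  simp only [bv, y10v_smul hs]

theorem cv_smul {s : k} (hs : s ≠ 0) (x21 x31 x32 : k) :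
    cv (s*x21) (s*x31) (s^2*x32) = (s^2)⁻¹ * cv x21 x31 x32 := by
  simp only [cv, y11v_smul hs, y21v_smul hs, y32v_smul hs]
  ring

theorem dv_smul {s : k} (hs : s ≠ 0) (x21 x31 x32 : k) :
    dv (s*x21) (s*x31) (s^2*x32) = s⁻¹ * dv x21 x31 x32 := by
  simp only [dv, y10v_smul hs, y11v_smul hs, y21v_smul hs, y31v_smul hs]
  ring

/-- Homogeneity (Lemma 1.5.4): replacing `(x21, x31, x32)` by `(s·x21, s·x31, s²·x32)`
changes `(y10, y11, y21, y31, y32)` to `(y10, s⁻¹y11, s⁻¹y21, s⁻¹y31, s⁻²y32)`; hence it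
leaves `t1` unchanged, changes `t2` to `s⁻²·t2`, and changes `x1, x2` to `s·x1, s·x2`. -/
theorem homogeneity_lemma [CharZero k] (s x21 x31 x32 : k) (hs : s ≠ 0)
    (h21 : x21 ≠ 0) (h32 : x32 ≠ 0) (hD : Dv x21 x31 x32 ≠ 0)
    (hc : cv x21 x31 x32 ≠ 0) :
    y10v (s*x21) (s*x31) (s^2*x32) = y10v x21 x31 x32 ∧
    y11v (s*x21) (s*x31) (s^2*x32) = s⁻¹ * y11v x21 x31 x32 ∧
    y21v (s*x21) (s*x31) (s^2*x32) = s⁻¹ * y21v x21 x31 x32 ∧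
    y31v (s*x21) (s*x31) (s^2*x32) = s⁻¹ * y31v x21 x31 x32 ∧
    y32v (s*x21) (s*x31) (s^2*x32) = (s^2)⁻¹ * y32v x21 x31 x32 ∧
    t1v (s*x21) (s*x31) (s^2*x32) = t1v x21 x31 x32 ∧
    t2v (s*x21) (s*x31) (s^2*x32) = (s^2)⁻¹ * t2v x21 x31 x32 ∧
    x1v (s*x21) (s*x31) (s^2*x32) = s * x1v x21 x31 x32 ∧
    x2v (s*x21) (s*x31) (s^2*x32) = s * x2v x21 x31 x32 := by
  refine ⟨y10v_smul hs .., y11v_smul hs .., y21v_smul hs .., y31v_smul hs .., y32v_smul hs ..,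
    ?_, ?_, ?_, ?_⟩
  · simp only [t1v, av_smul hs, bv_smul hs, cv_smul hs, dv_smul hs]
    field_simp
  · simp only [t2v, cv_smul hs, mul_neg]
  · simp only [x1v, av_smul hs, cv_smul hs]
    field_simp
  · simp only [x2v, dv_smul hs, cv_smul hs]
    field_simp

end
end

section
/- For every (y10, y11, y21, y31, y32) ∈ k⁵ there exist c10, c11, c21, c31, c32 ∈ k such that ẇ0⁻¹ · Ē(y10,y11,y21,y31,y32) · ẇ0 = E(c10, c11, c21, c31, c32). Moreover, if y10, y11, y21, y31, y32 are given by the formulas y10 = −x32/D, y11 = (−x31 + (1/2)x21)/D, y21 = −x21/D, y31 = ((1/2)x32·x21)/D², y32 = ((3/4)x21² + x32 + (1/2)x21·x31)/D² for x21, x31, x32 ∈ k with x21 ≠ 0, x32 ≠ 0, D := x21² + x32 ≠ 0, then the first coordinate is c10 = ((1/2)x21 − x31)/(x21² + x32). -/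
open Matrix

/-- The Weyl group representative `ẇ₀ = ẇ_l ẇ_β⁻¹` as a `7 × 7` matrix: its only nonzero
entries are `-1` in position `(1,5)`, `1` in `(2,4)`, `1` in `(3,6)`, `-1` in `(4,2)`,
`1` in `(5,1)`, `1` in `(6,3)` and `-1` in `(7,7)` (rows and columns numbered from 1). -/
def w0 {k : Type*} [Field k] : Matrix (Fin 7) (Fin 7) k :=
  !![0, 0, 0, 0, -1, 0, 0;
     0, 0, 0, 1, 0, 0, 0;
     0, 0, 0, 0, 0, 1, 0;
     0, -1, 0, 0, 0, 0, 0;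
     1, 0, 0, 0, 0, 0, 0;
     0, 0, 1, 0, 0, 0, 0;
     0, 0, 0, 0, 0, 0, -1]
theorem mexp_conj {k : Type*} [Field k] {W V : Matrix (Fin 7) (Fin 7) k} (h : V * W = 1)
    (A : Matrix (Fin 7) (Fin 7) k) : V * mexp A * W = mexp (V * A * W) := by
  have h' : W * V = 1 := mul_eq_one_comm.mp h
  have hpow (n : ℕ) : (V * A * W) ^ n = V * A ^ n * W := by
    induction n with
    | zero => simp [h]
    | succ n ih =>
      rw [pow_succ, ih, pow_succ]
      simp only [mul_assoc]
      rw [← mul_assoc W V, h', one_mul]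
  simp only [mexp, hpow, Finset.mul_sum, Finset.sum_mul, Matrix.mul_smul, Matrix.smul_mul]

/-- The inverse of `ẇ₀` is its transpose, since `ẇ₀` is a signed permutation matrix. -/
theorem transpose_w0_mul_w0 {k : Type*} [Field k] :
    (w0 : Matrix (Fin 7) (Fin 7) k)ᵀ * w0 = 1 := by
  ext i j
  fin_cases i <;> fin_cases j <;> simp [w0, Matrix.mul_apply, Fin.sum_univ_succ]

theorem transpose_w0_mul_Xmat_mul_w0 {k : Type*} [Field k] (y10 y11 y21 y31 y32 : k) :
    (w0 : Matrix (Fin 7) (Fin 7) k)ᵀ * Xmat 0 0 0 0 0 0 0 0 0 y10 y11 y21 y31 y32 * w0 =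
      Xmat 0 0 0 y11 (-y10) (-y21) y32 (-y31) 0 0 0 0 0 0 := by
  ext i j
  fin_cases i <;> fin_cases j <;>
    simp [w0, Xmat, Matrix.mul_apply, Fin.sum_univ_succ]

theorem w0_inv_mul_Ebar_mul_w0 {k : Type*} [Field k] (y10 y11 y21 y31 y32 : k) :
    (w0)⁻¹ * Ebar y10 y11 y21 y31 y32 * w0 = Emat y11 (-y10) (-y21) y32 (-y31) := by
  rw [Matrix.inv_eq_left_inv transpose_w0_mul_w0, Ebar, mexp_conj transpose_w0_mul_w0,
    transpose_w0_mul_Xmat_mul_w0, Emat]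

/-- The coordinate `x10` can be read off from the entry `(7, 5)` of `E(x10, ..., x32)`. -/
theorem Emat_apply_six_four {k : Type*} [Field k] (x10 x11 x21 x31 x32 : k) :
    Emat x10 x11 x21 x31 x32 6 4 = x10 := by
  set A : Matrix (Fin 7) (Fin 7) k := Xmat 0 0 0 x10 x11 x21 x31 x32 0 0 0 0 0 0 with hA
  have hsq (j : Fin 7) : (A ^ 2) 6 j = 0 := by
    rw [pow_two, hA]
    fin_cases j <;> simp [Xmat, Matrix.mul_apply, Fin.sum_univ_succ, mul_comm]
  have hpow (n : ℕ) : (A ^ (n + 2)) 6 4 = 0 := by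
    rw [add_comm, pow_add, Matrix.mul_apply]
    simp [hsq]
  have h1 : A 6 4 = x10 := by simp [hA, Xmat]
  rw [Emat, ← hA, mexp, Finset.sum_range_succ', Finset.sum_range_succ']
  simp [Matrix.add_apply, Matrix.sum_apply, hpow, h1]

/-- Conjugation by `ẇ₀` carries the opposite unipotent radical `N̄` into `N`:
`ẇ₀⁻¹ · Ē(y10,...,y32) · ẇ₀ = E(c10,...,c32)` for some `c10, ..., c32`; and when the
`y`'s come from the decomposition `ẇ₀⁻¹ n = m n' n̄` via the stated formulas, the first
coordinate is `c10 = ((1/2)x21 - x31)/(x21² + x32)`. -/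
theorem w0_conj_Ebar (k : Type*) [Field k] [CharZero k] :
    (∀ y10 y11 y21 y31 y32 : k, ∃ c10 c11 c21 c31 c32 : k,
      (w0)⁻¹ * Ebar y10 y11 y21 y31 y32 * w0 = Emat c10 c11 c21 c31 c32) ∧
    (∀ x21 x31 x32 : k, x21 ≠ 0 → x32 ≠ 0 → x21^2 + x32 ≠ 0 →
      letI D : k := x21^2 + x32
      letI y10 : k := -x32 / D
      letI y11 : k := (-x31 + (1/2)*x21) / D
      letI y21 : k := -x21 / D
      letI y31 : k := ((1/2)*x32*x21) / D^2
      letI y32 : k := ((3/4)*x21^2 + x32 + (1/2)*x21*x31) / D^2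
      ∀ c10 c11 c21 c31 c32 : k,
        (w0)⁻¹ * Ebar y10 y11 y21 y31 y32 * w0 = Emat c10 c11 c21 c31 c32 →
          c10 = ((1/2)*x21 - x31) / (x21^2 + x32)) := by
  refine ⟨fun y10 y11 y21 y31 y32 => ⟨_, _, _, _, _, w0_inv_mul_Ebar_mul_w0 ..⟩, ?_⟩
  intro x21 x31 x32 _ _ _ c10 c11 c21 c31 c32 h
  rw [w0_inv_mul_Ebar_mul_w0] at h
  have h64 := congrFun (congrFun h 6) 4
  rw [Emat_apply_six_four, Emat_apply_six_four] at h64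
  rw [← h64]
  ring
end

section
/- The set N̄ = {Ē(y10,y11,y21,y31,y32) : (y10,…,y32) ∈ k⁵} is closed under matrix multiplication: for all y = (y10,y11,y21,y31,y32) and y' = (y10',y11',y21',y31',y32') in k⁵ there exists a unique z = (z10,z11,z21,z31,z32) ∈ k⁵ with Ē(y)·Ē(y') = Ē(z), and its first three coordinates are z10 = y10 + y10', z11 = y11 + y11', z21 = y11·y10' − y10·y11' + y21 + y21'. Moreover z31 − y31 − y31' and z32 − y32 − y32' are polynomial expressions in the coordinates of y and y' each of whose monomials involves at least one coordinate of y and at least one coordinate of y'. -/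
open Matrix

/-- A truncated exponential series stops after the quadratic term when the cube vanishes. -/
theorem mexp_eq_of_pow_three_eq_zero {k : Type*} [Field k] {A : Matrix (Fin 7) (Fin 7) k}
    (hA : A ^ 3 = 0) : mexp A = 1 + A + (2 : k)⁻¹ • (A * A) := by
  have h (n : ℕ) : A ^ (n + 3) = 0 := by rw [pow_add, hA, mul_zero]
  simp [mexp, Finset.sum_range_succ, h 0, h 1, h 2, h 3, pow_two]

theorem Xmat_lower_mul_self {k : Type*} [Field k] (a b c d e : k) :
    Xmat 0 0 0 0 0 0 0 0 0 a b c d e * Xmat 0 0 0 0 0 0 0 0 0 a b c d e =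
      !![0, 0, 0, 0, 0, 0, 0;
         0, 0, 0, 0, 0, 0, 0;
         b * c, a * c, 0, 0, 0, 2 * (a * e - b * d + c ^ 2), 0;
         2 * b ^ 2, 2 * (a * b), 0, 0, 0, b * c, 0;
         2 * (a * b), 2 * a ^ 2, 0, 0, 0, a * c, 0;
         0, 0, 0, 0, 0, 0, 0;
         0, 0, 0, 0, 0, 0, 0] := by
  ext i j
  fin_cases i <;> fin_cases j <;>
    simp [Xmat, Matrix.mul_apply, Fin.sum_univ_succ, -mul_eq_zero] <;> ring

theorem Xmat_lower_pow_three {k : Type*} [Field k] (a b c d e : k) :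
    Xmat 0 0 0 0 0 0 0 0 0 a b c d e ^ 3 = 0 := by
  rw [pow_succ, pow_two, Xmat_lower_mul_self]
  ext i j
  fin_cases i <;> fin_cases j <;>
    simp [Xmat, Matrix.mul_apply, Fin.sum_univ_succ, -mul_eq_zero] <;> ring

theorem Ebar_eq {k : Type*} [Field k] [CharZero k] (a b c d e : k) :
    Ebar a b c d e =
      !![1, 0, 0, 0, 0, a, 0;
         0, 1, 0, 0, 0, -b, 0;
         e + b * c / 2, d + a * c / 2, 1, -a, b, a * e - b * d + c ^ 2, 2 * c;
         b ^ 2, c + a * b, 0, 1, 0, -e + b * c / 2, 2 * b;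
         -c + a * b, a ^ 2, 0, 0, 1, -d + a * c / 2, 2 * a;
         0, 0, 0, 0, 0, 1, 0;
         b, a, 0, 0, 0, c, 1] := by
  rw [Ebar, mexp_eq_of_pow_three_eq_zero (Xmat_lower_pow_three a b c d e), Xmat_lower_mul_self]
  ext i j
  fin_cases i <;> fin_cases j <;> simp [Xmat] <;> ring

theorem Ebar_inj {k : Type*} [Field k] [CharZero k] {a b c d e a' b' c' d' e' : k} :
    Ebar a b c d e = Ebar a' b' c' d' e' ↔
      a = a' ∧ b = b' ∧ c = c' ∧ d = d' ∧ e = e' := by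
  refine ⟨fun h => ?_, by rintro ⟨rfl, rfl, rfl, rfl, rfl⟩; rfl⟩
  rw [Ebar_eq, Ebar_eq] at h
  have ha : a = a' := by simpa using congrFun (congrFun h 6) 1
  have hb : b = b' := by simpa using congrFun (congrFun h 6) 0
  have hc : c = c' := by simpa using congrFun (congrFun h 6) 5
  subst ha hb hc
  exact ⟨rfl, rfl, rfl, by simpa using congrFun (congrFun h 2) 1,
    by simpa using congrFun (congrFun h 2) 0⟩

/-- The non-additive part of the `31`- and `32`-coordinates of
`Ē(a, b, c, d, e) * Ē(a', b', c', d', e')`, for `t = a * b' - b * a'` and `x, x'` equal to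
`a, a'` and `b, b'` respectively; `h` is `1 / 2`. -/
def nbarCocycle {R : Type*} [CommRing R] (h t x c x' c' : R) : R :=
  h * (3 * (c * x' - x * c') + (x - x') * t)

set_option maxHeartbeats 1000000 in
theorem Ebar_mul {k : Type*} [Field k] [CharZero k] (a b c d e a' b' c' d' e' : k) :
    Ebar a b c d e * Ebar a' b' c' d' e' =
      Ebar (a + a') (b + b') (b * a' - a * b' + c + c')
        (d + d' + nbarCocycle 2⁻¹ (a * b' - b * a') a c a' c')
        (e + e' + nbarCocycle 2⁻¹ (a * b' - b * a') b c b' c') := by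
  rw [Ebar_eq, Ebar_eq, Ebar_eq]
  ext i j
  fin_cases i <;> fin_cases j <;>
    simp [Matrix.mul_apply, Fin.sum_univ_succ, nbarCocycle] <;> ring

theorem map_nbarCocycle {R S : Type*} [CommRing R] [CommRing S] (f : R →+* S)
    (h t x c x' c' : R) :
    f (nbarCocycle h t x c x' c') = nbarCocycle (f h) (f t) (f x) (f c) (f x') (f c') := by
  simp [nbarCocycle, map_ofNat]

theorem nbarCocycle_mem_left {R : Type*} [CommRing R] {I : Ideal R} {t x c : R}
    (ht : t ∈ I) (hx : x ∈ I) (hc : c ∈ I) (h x' c' : R) : nbarCocycle h t x c x' c' ∈ I :=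
  I.mul_mem_left _ <| add_mem
    (I.mul_mem_left _ <| sub_mem (I.mul_mem_right _ hc) (I.mul_mem_right _ hx))
    (I.mul_mem_left _ ht)

theorem nbarCocycle_mem_right {R : Type*} [CommRing R] {I : Ideal R} {t x' c' : R}
    (ht : t ∈ I) (hx' : x' ∈ I) (hc' : c' ∈ I) (h x c : R) : nbarCocycle h t x c x' c' ∈ I :=
  I.mul_mem_left _ <| add_mem
    (I.mul_mem_left _ <| sub_mem (I.mul_mem_left _ hx') (I.mul_mem_left _ hc'))
    (I.mul_mem_left _ ht)

open MvPolynomial in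
/-- `nbarCocycle` evaluated at generic coordinates: those of the first factor are the variables
`0, …, 4`, those of the second factor are the variables `5, …, 9`, and `i`, `j` are the
indices of `x`, `x'` among these variables. -/
noncomputable def nbarCocyclePoly (k : Type*) [Field k] (i j : Fin 10) : MvPolynomial (Fin 10) k :=
  nbarCocycle (C 2⁻¹) (X 0 * X 6 - X 1 * X 5) (X i) (X 2) (X j) (X 7)

open MvPolynomial in
theorem nbarCocyclePoly_support {k : Type*} [Field k] {i j : Fin 10} (hi : i.val < 5)
    (hj : 5 ≤ j.val) :
    ∀ m ∈ (nbarCocyclePoly k i j).support,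
      (∃ i : Fin 10, i.val < 5 ∧ m i ≠ 0) ∧ (∃ i : Fin 10, 5 ≤ i.val ∧ m i ≠ 0) := by
  have hX {s : Set (Fin 10)} {l : Fin 10} (hl : l ∈ s) :
      (X l : MvPolynomial (Fin 10) k) ∈ Ideal.span (X '' s) :=
    Ideal.subset_span ⟨l, hl, rfl⟩
  have left : nbarCocyclePoly k i j ∈ Ideal.span (X '' {l : Fin 10 | l.val < 5}) :=
    nbarCocycle_mem_left
      (sub_mem (Ideal.mul_mem_right _ _ (hX (by simp))) (Ideal.mul_mem_right _ _ (hX (by simp))))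
      (hX hi) (hX (by simp)) _ _ _
  have right : nbarCocyclePoly k i j ∈ Ideal.span (X '' {l : Fin 10 | 5 ≤ l.val}) :=
    nbarCocycle_mem_right
      (sub_mem (Ideal.mul_mem_left _ _ (hX (by simp))) (Ideal.mul_mem_left _ _ (hX (by simp))))
      (hX hj) (hX (by simp)) _ _ _
  exact fun m hm => ⟨mem_ideal_span_X_image.1 left m hm, mem_ideal_span_X_image.1 right m hm⟩

theorem eval_nbarCocyclePoly {k : Type*} [Field k] (i j : Fin 10) (v : Fin 10 → k) :
    MvPolynomial.eval v (nbarCocyclePoly k i j) =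
      nbarCocycle 2⁻¹ (v 0 * v 6 - v 1 * v 5) (v i) (v 2) (v j) (v 7) := by
  simp [nbarCocyclePoly, map_nbarCocycle]

/-- The set `N̄ = {Ē(y10,y11,y21,y31,y32)}` is closed under multiplication, with group law
`Ē(y)·Ē(y') = Ē(z)` where `z10 = y10 + y10'`, `z11 = y11 + y11'`,
`z21 = y11·y10' - y10·y11' + y21 + y21'`, and `z31 - y31 - y31'`, `z32 - y32 - y32'` are
polynomials in the coordinates of `y` and `y'` each of whose monomials involves at least
one coordinate of `y` and at least one coordinate of `y'`.  Here a quintuple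
`(y10,y11,y21,y31,y32)` is encoded as `y : Fin 5 → k`, and `Fin.append y y'` lists the ten
coordinates, those of `y` first. -/
theorem nbar_multiplication (k : Type*) [Field k] [CharZero k] :
    (∀ y y' : Fin 5 → k, ∃! z : Fin 5 → k,
      Ebar (y 0) (y 1) (y 2) (y 3) (y 4) * Ebar (y' 0) (y' 1) (y' 2) (y' 3) (y' 4) =
        Ebar (z 0) (z 1) (z 2) (z 3) (z 4)) ∧
    ∃ P31 P32 : MvPolynomial (Fin 10) k,
      (∀ m ∈ P31.support,
        (∃ i : Fin 10, i.val < 5 ∧ m i ≠ 0) ∧ (∃ i : Fin 10, 5 ≤ i.val ∧ m i ≠ 0)) ∧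
      (∀ m ∈ P32.support,
        (∃ i : Fin 10, i.val < 5 ∧ m i ≠ 0) ∧ (∃ i : Fin 10, 5 ≤ i.val ∧ m i ≠ 0)) ∧
      (∀ y y' z : Fin 5 → k,
        Ebar (y 0) (y 1) (y 2) (y 3) (y 4) * Ebar (y' 0) (y' 1) (y' 2) (y' 3) (y' 4) =
          Ebar (z 0) (z 1) (z 2) (z 3) (z 4) →
        z 0 = y 0 + y' 0 ∧
        z 1 = y 1 + y' 1 ∧
        z 2 = y 1 * y' 0 - y 0 * y' 1 + y 2 + y' 2 ∧
        z 3 = y 3 + y' 3 + MvPolynomial.eval (Fin.append y y') P31 ∧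
        z 4 = y 4 + y' 4 + MvPolynomial.eval (Fin.append y y') P32) := by
  simp only [Ebar_mul, Ebar_inj]
  refine ⟨fun y y' => ?_, nbarCocyclePoly k 0 5, nbarCocyclePoly k 1 6,
    nbarCocyclePoly_support (by simp) (by simp), nbarCocyclePoly_support (by simp) (by simp),
    fun y y' z h => ?_⟩
  · refine ⟨![_, _, _, _, _], ⟨rfl, rfl, rfl, rfl, rfl⟩, ?_⟩
    rintro z ⟨h0, h1, h2, h3, h4⟩
    ext i
    fin_cases i
    exacts [h0.symm, h1.symm, h2.symm, h3.symm, h4.symm]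
  · obtain ⟨h0, h1, h2, h3, h4⟩ := h
    rw [eval_nbarCocyclePoly, eval_nbarCocyclePoly]
    exact ⟨h0.symm, h1.symm, h2.symm, h3.symm, h4.symm⟩
end
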